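/- arXiv:math/0001170 — 7 statements merged into one kernel-verified Lean document; each statement's English description precedes it below -/
import Mathlib

section
/- The height function on ℤ^N is subadditive: ht(α + β) ≤ ht(α) + ht(β) for all α, β ∈ ℤ^N; moreover equality ht(α + β) = ht(α) + ht(β) holds if and only if there exists an index j ∈ {1, …, N+1} such that both α and β belong to the cone Δ_j. -/
/-- The `N+1` lattice vectors: `ξ i = e i` for `i < N`, and
`ξ N = -(e 1 + ⋯ + e N)`, i.e. the all `-1` vector. -/
noncomputable def xi (N : ℕ) (i : Fin (N + 1)) : Fin N → ℤ :=
  if h : (i : ℕ) < N then Pi.single ⟨i, h⟩ 1 else fun _ => -1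

/-- For `S ⊆ {1, …, N+1}`, the cone `Δ_S` of nonnegative integral
combinations of the `ξ i`, `i ∈ S`. -/
def DeltaS (N : ℕ) (S : Set (Fin (N + 1))) : Set (Fin N → ℤ) :=
  {α | ∃ n : Fin (N + 1) → ℕ, (∀ j ∉ S, n j = 0) ∧
    α = ∑ i : Fin (N + 1), (n i : ℤ) • xi N i}

/-- The maximal cone `Δ_i`, generated by all `ξ j` with `j ≠ i`. -/
def Delta (N : ℕ) (i : Fin (N + 1)) : Set (Fin N → ℤ) :=
  DeltaS N {i}ᶜ

theorem sum_smul_xi_apply (N : ℕ) (a : Fin (N + 1) → ℤ) (k : Fin N) :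
    (∑ i, a i • xi N i) k = a k.castSucc - a (Fin.last N) := by
  simp [Fin.sum_univ_castSucc, xi, Pi.single_apply, sub_eq_add_neg]

/-- The constant vectors are the only relations between the `xi N i`. -/
theorem eq_add_of_sum_smul_xi_eq {N : ℕ} {a b : Fin (N + 1) → ℤ}
    (h : ∑ i, a i • xi N i = ∑ i, b i • xi N i) (i : Fin (N + 1)) :
    a i = b i + (a (Fin.last N) - b (Fin.last N)) := by
  induction i using Fin.lastCases with
  | last => ring
  | cast k =>
    have hk := congrFun h k
    rw [sum_smul_xi_apply, sum_smul_xi_apply] at hk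
    linarith

theorem mem_Delta_iff {N : ℕ} {α : Fin N → ℤ} {m : Fin (N + 1) → ℕ}
    (hm : α = ∑ i, (m i : ℤ) • xi N i) (hm0 : ∃ i, m i = 0) (j : Fin (N + 1)) :
    α ∈ Delta N j ↔ m j = 0 := by
  constructor
  · rintro ⟨m', hj, hm'⟩
    obtain ⟨i, hi⟩ := hm0
    have hj' : m' j = 0 := hj j (by simp)
    have h := eq_add_of_sum_smul_xi_eq (hm.symm.trans hm')
    have h₁ := h i
    have h₂ := h j
    omega
  · intro hj
    refine ⟨m, fun i hi => ?_, hm⟩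
    obtain rfl : i = j := by simpa using hi
    exact hj

/-- The height function is subadditive, with equality iff `α` and `β`
lie in a common cone `Δ_j`.  Here `m`, `n`, `p` are the unique
representations of `α`, `β`, `α + β` respectively. -/
theorem height_subadditive (N : ℕ) (hN : 1 ≤ N) (α β : Fin N → ℤ)
    (m n p : Fin (N + 1) → ℕ)
    (hm : α = ∑ i : Fin (N + 1), (m i : ℤ) • xi N i) (hm0 : ∃ i, m i = 0)
    (hn : β = ∑ i : Fin (N + 1), (n i : ℤ) • xi N i) (hn0 : ∃ i, n i = 0)
    (hp : α + β = ∑ i : Fin (N + 1), (p i : ℤ) • xi N i) (hp0 : ∃ i, p i = 0) :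
    (∑ i : Fin (N + 1), p i) ≤ (∑ i : Fin (N + 1), m i) + (∑ i : Fin (N + 1), n i) ∧
      ((∑ i : Fin (N + 1), p i) = (∑ i : Fin (N + 1), m i) + (∑ i : Fin (N + 1), n i) ↔
        ∃ j : Fin (N + 1), α ∈ Delta N j ∧ β ∈ Delta N j) := by
  have hsum : ∑ i, ((m i : ℤ) + n i) • xi N i = ∑ i, (p i : ℤ) • xi N i := by
    simp only [add_smul, Finset.sum_add_distrib]
    rw [← hm, ← hn, hp]
  have hshift := eq_add_of_sum_smul_xi_eq hsum
  generalize (m (Fin.last N) : ℤ) + n (Fin.last N) - p (Fin.last N) = c at hshift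
  obtain ⟨j, hj⟩ := hp0
  have hc : 0 ≤ c := by
    have := hshift j
    omega
  have htotal : (∑ i, (m i : ℤ)) + ∑ i, (n i : ℤ) = ∑ i, (p i : ℤ) + (N + 1) * c := by
    rw [← Finset.sum_add_distrib, Finset.sum_congr rfl fun i _ => hshift i]
    simp [Finset.sum_add_distrib]
  simp only [mem_Delta_iff hm hm0, mem_Delta_iff hn hn0]
  zify
  rw [htotal]
  refine ⟨le_add_of_nonneg_right (by positivity), fun h => ⟨j, ?_⟩, ?_⟩
  · have hc0 : c = 0 := by
      have h0 : ((N : ℤ) + 1) * c = 0 := by linarith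
      exact (mul_eq_zero.mp h0).resolve_left (by positivity)
    have := hshift j
    omega
  · rintro ⟨i, hmi, hni⟩
    have hc0 : c = 0 := by
      have := hshift i
      omega
    simp [hc0]
end

section
/- For every q ∈ ℂ, the images of the elements x_1 − T, x_2 − T, …, x_N − T form a regular sequence in the ring R_q = ℂ[x_1, …, x_N, T]/(T·x_1⋯x_N − q^{N+1}). -/
open MvPolynomial

/-- The ideal `(T·x_1⋯x_N − q^{N+1})` in `ℂ[x_1, …, x_N, T]`, the
variables being indexed by `Option (Fin N)` with `T = X none` and
`x_i = X (some i)`. -/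
noncomputable def relIdeal (N : ℕ) (q : ℂ) : Ideal (MvPolynomial (Option (Fin N)) ℂ) :=
  Ideal.span {(X none * (∏ i : Fin N, X (some i)) -
    C (q ^ (N + 1)) : MvPolynomial (Option (Fin N)) ℂ)}

section Collapse

variable {σ K : Type*} [CommRing K]

/-- The ideal of `K[x_i, T]` generated by the differences `x_i - T` with `i ∈ S`. -/
noncomputable def diagIdeal (K : Type*) [CommRing K] (S : Set σ) :
    Ideal (MvPolynomial (Option σ) K) :=
  Ideal.span ((fun i => X (some i) - X none) '' S)

open Classical in
/-- The endomorphism of `K[x_i, T]` sending `x_i` to `T` for `i ∈ S` and fixing the other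
variables. -/
noncomputable def collapse (K : Type*) [CommRing K] (S : Set σ) :
    MvPolynomial (Option σ) K →ₐ[K] MvPolynomial (Option σ) K :=
  aeval fun o => o.elim (X none) fun i => if i ∈ S then X none else X (some i)

@[simp]
lemma collapse_X_none (S : Set σ) : collapse K S (X none) = X none := by
  simp [collapse]

lemma collapse_X_some_of_mem {S : Set σ} {i : σ} (hi : i ∈ S) :
    collapse K S (X (some i)) = X none := by
  simp [collapse, hi]

lemma collapse_X_some_of_notMem {S : Set σ} {i : σ} (hi : i ∉ S) :
    collapse K S (X (some i)) = X (some i) := by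
  simp [collapse, hi]

lemma collapse_eq_zero_of_mem {S : Set σ} {p : MvPolynomial (Option σ) K}
    (hp : p ∈ diagIdeal K S) : collapse K S p = 0 := by
  have hle : diagIdeal K S ≤ RingHom.ker (collapse K S) := by
    rw [diagIdeal, Ideal.span_le]
    rintro _ ⟨i, hi, rfl⟩
    simp [RingHom.mem_ker, collapse_X_some_of_mem hi]
  exact hle hp

lemma sub_collapse_mem (S : Set σ) (p : MvPolynomial (Option σ) K) :
    p - collapse K S p ∈ diagIdeal K S := by
  have h : (Ideal.Quotient.mkₐ K (diagIdeal K S)).comp (collapse K S) =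
      Ideal.Quotient.mkₐ K (diagIdeal K S) := by
    ext o
    rcases o with _ | i
    · simp
    · by_cases hi : i ∈ S
      · simp only [AlgHom.comp_apply, collapse_X_some_of_mem hi, Ideal.Quotient.mkₐ_eq_mk]
        exact (Ideal.Quotient.eq.mpr
          (Ideal.subset_span (Set.mem_image_of_mem _ hi) :
            X (some i) - X none ∈ diagIdeal K S)).symm
      · simp [collapse_X_some_of_notMem hi]
  exact Ideal.Quotient.eq.mp (DFunLike.congr_fun h p).symm

lemma eval_const_collapse (S : Set σ) (t : K) (p : MvPolynomial (Option σ) K) :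
    eval (fun _ => t) (collapse K S p) = eval (fun _ => t) p := by
  have h : (aeval fun _ => t : MvPolynomial (Option σ) K →ₐ[K] K).comp (collapse K S) =
      aeval fun _ => t := by
    ext o
    rcases o with _ | i
    · simp
    · by_cases hi : i ∈ S
      · simp [collapse_X_some_of_mem hi]
      · simp [collapse_X_some_of_notMem hi]
  simpa [aeval_eq_eval] using DFunLike.congr_fun h p

/-- If `f` does not vanish identically on the diagonal line, then `x_i - T` is a nonzerodivisor
modulo `f` and the differences `x_j - T` for `j ∈ S`, where `i ∉ S`. -/
lemma mem_diagIdeal_sup_span_of_mul_mem [IsDomain K] {S : Set σ} {i : σ} (hi : i ∉ S)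
    {f : MvPolynomial (Option σ) K} {t : K} (hf : eval (fun _ => t) f ≠ 0)
    {m : MvPolynomial (Option σ) K}
    (hm : (X (some i) - X none) * m ∈ diagIdeal K S ⊔ Ideal.span {f}) :
    m ∈ diagIdeal K S ⊔ Ideal.span {f} := by
  obtain ⟨u, hu, v, hv, huv⟩ := Submodule.mem_sup.mp hm
  obtain ⟨a, rfl⟩ := Ideal.mem_span_singleton'.mp hv
  have hS := congrArg (collapse K S) huv
  simp only [map_add, map_mul, map_sub, collapse_eq_zero_of_mem hu, collapse_X_none,
    collapse_X_some_of_notMem hi, zero_add] at hS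
  have ha : collapse K {i} (collapse K S a) = 0 := by
    have h := congrArg (collapse K {i}) hS
    simp only [map_mul, map_sub, collapse_X_none,
      collapse_X_some_of_mem (Set.mem_singleton i), sub_self, zero_mul] at h
    refine (mul_eq_zero.mp h).resolve_right fun h0 => hf ?_
    rw [← eval_const_collapse S, ← eval_const_collapse {i}, h0, map_zero]
  have hdvd := sub_collapse_mem {i} (collapse K S a)
  rw [ha, sub_zero, diagIdeal, Set.image_singleton] at hdvd
  obtain ⟨b, hb⟩ := Ideal.mem_span_singleton.mp hdvd
  have hne : (X (some i) - X none : MvPolynomial (Option σ) K) ≠ 0 :=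
    sub_ne_zero.mpr fun h => by simpa using X_injective h
  have hbm : b * collapse K S f = collapse K S m := by
    refine mul_left_cancel₀ hne ?_
    rw [← hS, hb, mul_assoc]
  have hsub : m - b * f = (m - collapse K S m) - b * (f - collapse K S f) := by
    rw [← hbm]; ring
  refine Submodule.mem_sup.mpr ⟨m - b * f, ?_, b * f,
    Ideal.mul_mem_left _ _ (Ideal.mem_span_singleton_self f), by ring⟩
  rw [hsub]
  exact sub_mem (sub_collapse_mem S m) (Ideal.mul_mem_left _ _ (sub_collapse_mem S f))

lemma diagIdeal_le_ker_eval_const (S : Set σ) (t : K) :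
    diagIdeal K S ≤ RingHom.ker (eval fun _ : Option σ => t) := by
  rw [diagIdeal, Ideal.span_le]
  rintro _ ⟨i, -, rfl⟩
  simp [RingHom.mem_ker]

end Collapse

lemma ofList_take_ofFn_eq_map {N : ℕ} {K : Type*} [CommRing K]
    (I : Ideal (MvPolynomial (Option (Fin N)) K)) (k : ℕ) :
    Ideal.ofList ((List.ofFn fun i : Fin N =>
        Ideal.Quotient.mk I (X (some i) - X none)).take k) =
      (diagIdeal K {i : Fin N | (i : ℕ) < k}).map (Ideal.Quotient.mk I) := by
  rw [diagIdeal, Ideal.map_span, Ideal.ofList]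
  congr 1
  ext r
  simp only [Set.mem_ofPred_eq, List.mem_take_iff_getElem, List.getElem_ofFn, List.length_ofFn,
    Set.mem_image, exists_exists_and_eq_and]
  constructor
  · rintro ⟨j, hj, rfl⟩
    exact ⟨⟨j, by omega⟩, by simp; omega, rfl⟩
  · rintro ⟨i, hi, rfl⟩
    exact ⟨i, by omega, rfl⟩

lemma exists_eval_const_relation_ne_zero (N : ℕ) (q : ℂ) :
    ∃ t : ℂ, eval (fun _ : Option (Fin N) => t)
      (X none * (∏ i : Fin N, X (some i)) - C (q ^ (N + 1))) ≠ 0 := by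
  by_cases hq : q = 0
  · exact ⟨1, by simp [hq]⟩
  · exact ⟨0, by simp [hq]⟩

lemma relIdeal_le_ker_eval_const (N : ℕ) (q : ℂ) :
    relIdeal N q ≤ RingHom.ker (eval fun _ : Option (Fin N) => q) := by
  rw [relIdeal, Ideal.span_le, Set.singleton_subset_iff]
  simp [RingHom.mem_ker, pow_succ']

/-- In `R_q = ℂ[x_1, …, x_N, T]/(T·x_1⋯x_N − q^{N+1})`, the images of
`x_1 − T, …, x_N − T` form a regular sequence. -/
theorem regular_sequence_in_Rq (N : ℕ) (hN : 1 ≤ N) (q : ℂ) :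
    RingTheory.Sequence.IsRegular
      (MvPolynomial (Option (Fin N)) ℂ ⧸ relIdeal N q)
      (List.ofFn fun i : Fin N =>
        Ideal.Quotient.mk (relIdeal N q) (X (some i) - X none)) := by
  have htop (J : Ideal (MvPolynomial (Option (Fin N)) ℂ ⧸ relIdeal N q)) :
      J • (⊤ : Submodule (MvPolynomial (Option (Fin N)) ℂ ⧸ relIdeal N q)
        (MvPolynomial (Option (Fin N)) ℂ ⧸ relIdeal N q)) = J := by
    rw [smul_eq_mul, Ideal.mul_top]
  refine ⟨⟨fun k hk => ?_⟩, fun h => ?_⟩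
  · rw [isSMulRegular_quotient_iff_mem_of_smul_mem, htop, ofList_take_ofFn_eq_map]
    intro x hx
    obtain ⟨m, rfl⟩ := Ideal.Quotient.mk_surjective x
    obtain ⟨t, ht⟩ := exists_eval_const_relation_ne_zero N q
    rw [List.getElem_ofFn, smul_eq_mul, ← map_mul, Ideal.mem_quotient_iff_mem_sup] at hx
    rw [Ideal.mem_quotient_iff_mem_sup]
    exact mem_diagIdeal_sup_span_of_mul_mem (by simp) ht hx
  · rw [htop, ← List.take_length (l := List.ofFn _), ofList_take_ofFn_eq_map] at h
    have h1 : Ideal.Quotient.mk (relIdeal N q) 1 ∈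
        (diagIdeal ℂ _).map (Ideal.Quotient.mk (relIdeal N q)) := h ▸ Submodule.mem_top
    rw [Ideal.mem_quotient_iff_mem_sup] at h1
    have h2 := sup_le (diagIdeal_le_ker_eval_const _ q) (relIdeal_le_ker_eval_const N q) h1
    simp [RingHom.mem_ker] at h2
end

section
/- Suppose d_1 is acyclic, i.e. for every n ∈ ℤ, ker(d_1 : W^n → W^{n+1}) = im(d_1 : W^{n−1} → W^n). Fix n ∈ ℤ and let (x_i)_{i≥0} be a family with x_i ∈ W^{n−2i} satisfying d_1(x_0) = 0 and d_1(x_{i+1}) + d_2(x_i) = 0 for all i ≥ 0. Then there exists a family (y_i)_{i≥0} with y_i ∈ W^{n−2i−1} such that d_1(y_0) = x_0 and d_1(y_{i+1}) + d_2(y_i) = x_{i+1} for all i ≥ 0. -/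
/-- Given a `ℤ`-graded complex `W = ⊕ₙ Wⁿ` with anticommuting differentials
`d₁ : Wⁿ → Wⁿ⁺¹` and `d₂ : Wⁿ → Wⁿ⁻¹`, if `d₁` is acyclic then any chain
`(xᵢ)` with `xᵢ ∈ Wⁿ⁻²ⁱ`, `d₁ x₀ = 0` and `d₁ xᵢ₊₁ + d₂ xᵢ = 0` can be
lifted to a chain `(yᵢ)` with `yᵢ ∈ Wⁿ⁻²ⁱ⁻¹`, `d₁ y₀ = x₀` and
`d₁ yᵢ₊₁ + d₂ yᵢ = xᵢ₊₁`. -/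
theorem chain_lifting
    {W : Type*} [AddCommGroup W] [Module ℂ W]
    (𝒲 : ℤ → Submodule ℂ W) (hinternal : DirectSum.IsInternal 𝒲)
    (d1 d2 : W →ₗ[ℂ] W)
    (hmap1 : ∀ n : ℤ, Submodule.map d1 (𝒲 n) ≤ 𝒲 (n + 1))
    (hmap2 : ∀ n : ℤ, Submodule.map d2 (𝒲 n) ≤ 𝒲 (n - 1))
    (hd1 : d1 ∘ₗ d1 = 0) (hd2 : d2 ∘ₗ d2 = 0)
    (hanti : d1 ∘ₗ d2 + d2 ∘ₗ d1 = 0)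
    (hacyclic : ∀ n : ℤ, 𝒲 n ⊓ LinearMap.ker d1 = Submodule.map d1 (𝒲 (n - 1)))
    (n : ℤ) (x : ℕ → W)
    (hx : ∀ i : ℕ, x i ∈ 𝒲 (n - 2 * i))
    (hx0 : d1 (x 0) = 0)
    (hxrec : ∀ i : ℕ, d1 (x (i + 1)) + d2 (x i) = 0) :
    ∃ y : ℕ → W, (∀ i : ℕ, y i ∈ 𝒲 (n - 2 * i - 1)) ∧
      d1 (y 0) = x 0 ∧ ∀ i : ℕ, d1 (y (i + 1)) + d2 (y i) = x (i + 1) := by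
  have exists_preimage (m : ℤ) (w : W) (hw : w ∈ 𝒲 m) (h : d1 w = 0) :
      ∃ z ∈ 𝒲 (m - 1), d1 z = w := by
    have hmem : w ∈ 𝒲 m ⊓ LinearMap.ker d1 := ⟨hw, h⟩
    rw [hacyclic] at hmem
    exact hmem
  have step (i : ℕ) (y : W) :
      ∃ z, y ∈ 𝒲 (n - 2 * i - 1) ∧ d2 (d1 y) = d2 (x i) →
        (z ∈ 𝒲 (n - 2 * (i + 1 : ℕ) - 1) ∧ d2 (d1 z) = d2 (x (i + 1))) ∧
          d1 z + d2 y = x (i + 1) := by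
    by_cases hy : y ∈ 𝒲 (n - 2 * i - 1) ∧ d2 (d1 y) = d2 (x i)
    · have hd2y : d2 y ∈ 𝒲 (n - 2 * (i + 1 : ℕ)) := by
        have h := hmap2 _ (Submodule.mem_map_of_mem hy.1)
        rwa [show n - 2 * (i : ℤ) - 1 - 1 = n - 2 * (i + 1 : ℕ) by push_cast; ring] at h
      have hclosed : d1 (x (i + 1) - d2 y) = 0 := by
        have h : d1 (d2 y) + d2 (d1 y) = 0 := LinearMap.congr_fun hanti y
        rw [map_sub, eq_neg_of_add_eq_zero_left h, sub_neg_eq_add, hy.2, hxrec]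
      obtain ⟨z, hz, hzx⟩ := exists_preimage _ _ (sub_mem (hx (i + 1)) hd2y) hclosed
      have h : d2 (d2 y) = 0 := LinearMap.congr_fun hd2 y
      exact ⟨z, fun _ ↦ ⟨⟨hz, by rw [hzx, map_sub, h, sub_zero]⟩, by rw [hzx, sub_add_cancel]⟩⟩
    · exact ⟨0, fun h ↦ absurd h hy⟩
  choose next hnext using step
  obtain ⟨y₀, hy₀, hy₀x⟩ := exists_preimage _ _ (hx 0) hx0
  let y : ℕ → W := Nat.rec y₀ next
  have hy (i : ℕ) : y i ∈ 𝒲 (n - 2 * i - 1) ∧ d2 (d1 (y i)) = d2 (x i) := by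
    induction i with
    | zero => exact ⟨hy₀, congrArg d2 hy₀x⟩
    | succ i ih => exact (hnext i (y i) ih).1
  exact ⟨y, fun i ↦ (hy i).1, hy₀x, fun i ↦ (hnext i (y i) (hy i)).2⟩
end

section
/- Suppose each W^n decomposes as a direct sum W^n = W'^n ⊕ W''^n where both d_1 and d_2 map the W'-part to the W'-part and the W''-part to the W''-part, suppose d_1 vanishes identically on W', suppose there is n_0 ∈ ℤ with W''^n = 0 for n < n_0, and suppose d_1 is acyclic on W'' (for every n, ker(d_1 : W''^n → W''^{n+1}) = im(d_1 : W''^{n−1} → W''^n)). Then the inclusion W' ⊆ W induces an isomorphism of the cohomology of (W', d_2) with the cohomology of (W, d_1 + d_2): ker(d_2|_{W'})/im(d_2|_{W'}) ≅ ker(d_1 + d_2)/im(d_1 + d_2), where W = ⊕_n W^n and W' = ⊕_n W'^n. -/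
open DirectSum in
theorem decompose_mem_of_mem_iSup {R M : Type*} [Ring R] [AddCommGroup M] [Module R M]
    (𝒲 S : ℤ → Submodule R M) [Decomposition 𝒲] (hS : ∀ n, S n ≤ 𝒲 n)
    {x : M} (hx : x ∈ ⨆ n, S n) (n : ℤ) : (decompose 𝒲 x n : M) ∈ S n := by
  induction hx using Submodule.iSup_induction' with
  | mem m y hy =>
    by_cases h : m = n
    · subst h
      rwa [decompose_of_mem_same 𝒲 (hS m hy)]
    · rw [decompose_of_mem_ne 𝒲 (hS m hy) h]
      exact zero_mem _
  | zero => simp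
  | add y z _ _ hy hz => simpa using add_mem hy hz

open DirectSum in
theorem eq_zero_of_decompose_eq_zero {R M : Type*} [Ring R] [AddCommGroup M] [Module R M]
    (𝒲 : ℤ → Submodule R M) [Decomposition 𝒲] {x : M}
    (hx : ∀ n, (decompose 𝒲 x n : M) = 0) : x = 0 := by
  apply (decompose 𝒲).injective
  ext n
  simpa using hx n

open DirectSum in
theorem decompose_map_of_degree {R M : Type*} [Ring R] [AddCommGroup M] [Module R M]
    (𝒲 : ℤ → Submodule R M) [Decomposition 𝒲] (f : M →ₗ[R] M) (k : ℤ)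
    (hf : ∀ n, Submodule.map f (𝒲 n) ≤ 𝒲 (n + k)) (x : M) (n : ℤ) :
    (decompose 𝒲 (f x) (n + k) : M) = f (decompose 𝒲 x n) := by
  induction x using Decomposition.inductionOn 𝒲 with
  | zero => simp
  | @homogeneous m y =>
    have hy : f y ∈ 𝒲 (m + k) := hf m (Submodule.mem_map_of_mem y.2)
    by_cases h : m = n
    · subst h
      rw [decompose_of_mem_same 𝒲 hy, decompose_of_mem_same 𝒲 y.2]
    · rw [decompose_of_mem_ne 𝒲 hy (by simpa using h), decompose_of_mem_ne 𝒲 y.2 h, map_zero]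
  | add y z hy hz => simp [hy, hz]

open DirectSum in
theorem disjoint_iSup_of_graded {R M : Type*} [Ring R] [AddCommGroup M] [Module R M]
    (𝒲 S T : ℤ → Submodule R M) [Decomposition 𝒲] (hS : ∀ n, S n ≤ 𝒲 n) (hT : ∀ n, T n ≤ 𝒲 n)
    (hST : ∀ n, S n ⊓ T n = ⊥) : Disjoint (⨆ n, S n) (⨆ n, T n) := by
  refine Submodule.disjoint_def.2 fun x hx hx' ↦ eq_zero_of_decompose_eq_zero 𝒲 fun n ↦ ?_
  rw [← Submodule.mem_bot R, ← hST n]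
  exact ⟨decompose_mem_of_mem_iSup 𝒲 S hS hx n, decompose_mem_of_mem_iSup 𝒲 T hT hx' n⟩

theorem map_iSup_le_of_degree {R M : Type*} [Ring R] [AddCommGroup M] [Module R M]
    (S : ℤ → Submodule R M) (f : M →ₗ[R] M) (k : ℤ)
    (hf : ∀ n, Submodule.map f (S n) ≤ S (n + k)) {x : M} (hx : x ∈ ⨆ n, S n) :
    f x ∈ ⨆ n, S n := by
  have h : Submodule.map f (⨆ n, S n) ≤ ⨆ n, S n := by
    rw [Submodule.map_iSup]
    exact iSup_le fun n ↦ (hf n).trans (le_iSup S (n + k))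
  exact h (Submodule.mem_map_of_mem hx)

open DirectSum in
/-- If `d₁` is acyclic on a bounded below graded subspace `⨆ n, S n`, then so is `d₁ + d₂`: the
top component of a `(d₁ + d₂)`-cycle is a `d₁`-boundary, so subtracting a
boundary lowers the top degree. -/
theorem exists_add_apply_eq_of_acyclic {R M : Type*} [Ring R] [AddCommGroup M] [Module R M]
    (𝒲 S : ℤ → Submodule R M) [Decomposition 𝒲] (hS : ∀ n, S n ≤ 𝒲 n) (d1 d2 : M →ₗ[R] M)
    (hmap1 : ∀ n, Submodule.map d1 (𝒲 n) ≤ 𝒲 (n + 1))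
    (hmap2 : ∀ n, Submodule.map d2 (𝒲 n) ≤ 𝒲 (n - 1))
    (hmap1S : ∀ n, Submodule.map d1 (S n) ≤ S (n + 1))
    (hmap2S : ∀ n, Submodule.map d2 (S n) ≤ S (n - 1))
    (hd : ∀ x, (d1 + d2) ((d1 + d2) x) = 0)
    (n0 : ℤ) (hbound : ∀ n < n0, S n = ⊥)
    (hacyclic : ∀ n, S n ⊓ LinearMap.ker d1 = Submodule.map d1 (S (n - 1)))
    {x : M} (hx : x ∈ ⨆ n, S n) (hdx : (d1 + d2) x = 0) :
    ∃ y ∈ ⨆ n, S n, (d1 + d2) y = x := by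
  have key : ∀ k : ℕ, ∀ x ∈ ⨆ n, S n, (d1 + d2) x = 0 →
      (∀ n, n0 + k ≤ n → (decompose 𝒲 x n : M) = 0) → ∃ y ∈ ⨆ n, S n, (d1 + d2) y = x := by
    intro k
    induction k with
    | zero =>
      intro x hx _ htop
      refine ⟨0, zero_mem _, ?_⟩
      rw [map_zero, eq_comm]
      refine eq_zero_of_decompose_eq_zero 𝒲 fun n ↦ ?_
      rcases lt_or_ge n n0 with h | h
      · rw [← Submodule.mem_bot R, ← hbound n h]
        exact decompose_mem_of_mem_iSup 𝒲 S hS hx n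
      · exact htop n (by simpa using h)
    | succ k ih =>
      intro x hx hdx htop
      have hcycle : d1 (decompose 𝒲 x (n0 + k)) = 0 := by
        have h1 := decompose_map_of_degree 𝒲 d1 1 hmap1 x (n0 + k)
        have h2 := decompose_map_of_degree 𝒲 d2 (-1) hmap2 x (n0 + k + 2)
        rw [htop _ (by push_cast; omega), map_zero,
          show n0 + k + 2 + -1 = n0 + k + 1 by ring] at h2
        have h3 : (decompose 𝒲 ((d1 + d2) x) (n0 + k + 1) : M) = 0 := by simp [hdx]
        simpa [h1, h2] using h3
      obtain ⟨y, hy, hyx⟩ : (decompose 𝒲 x (n0 + k) : M) ∈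
          Submodule.map d1 (S (n0 + k - 1)) := by
        rw [← hacyclic]
        exact ⟨decompose_mem_of_mem_iSup 𝒲 S hS hx _, hcycle⟩
      have hyS : y ∈ ⨆ n, S n := le_iSup S _ hy
      have hdyS : (d1 + d2) y ∈ ⨆ n, S n :=
        add_mem (map_iSup_le_of_degree S d1 1 hmap1S hyS)
          (map_iSup_le_of_degree S d2 (-1) hmap2S hyS)
      obtain ⟨z, hz, hzx⟩ := ih (x - (d1 + d2) y) (sub_mem hx hdyS)
        (by rw [map_sub, hdx, hd, sub_zero]) fun n hn ↦ by
          have hd2y : (decompose 𝒲 (d2 y) n : M) = 0 :=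
            decompose_of_mem_ne 𝒲 (hmap2 _ (Submodule.mem_map_of_mem (hS _ hy))) (by omega)
          have hd1y : (decompose 𝒲 (d1 y) n : M) = decompose 𝒲 x n := by
            rw [hyx]
            by_cases h : n0 + k = n
            · rw [h, decompose_of_mem_same 𝒲 (SetLike.coe_mem _)]
            · rw [decompose_of_mem_ne 𝒲 (SetLike.coe_mem _) h, htop n (by push_cast; omega)]
          simp [hd1y, hd2y]
      exact ⟨z + y, add_mem hz hyS, by rw [map_add, hzx, sub_add_cancel]⟩
  classical
  obtain ⟨b, hb⟩ := ((decompose 𝒲 x).support).bddAbove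
  refine key (b + 1 - n0).toNat x hx hdx fun n hn ↦ ?_
  by_contra h
  have hnb := hb (DFinsupp.mem_support_iff.2 fun h0 ↦ h (by rw [h0]; rfl))
  omega

/-- The inclusion of a direct summand with acyclic complement induces an
isomorphism in cohomology. -/
theorem exists_cohomology_equiv_of_acyclic_compl {R M : Type*} [Ring R] [AddCommGroup M]
    [Module R M] (A B : Submodule R M) (hAB : IsCompl A B) (d d' : M →ₗ[R] M)
    (hA : ∀ x ∈ A, d x ∈ A) (hB : ∀ x ∈ B, d x ∈ B)
    (hd' : ∀ x ∈ A, d x = d' x) (hacyclic : ∀ x ∈ B, d x = 0 → ∃ y ∈ B, d y = x) :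
    ∃ hK : A ⊓ LinearMap.ker d' ≤ LinearMap.ker d,
      ∃ e : ((A ⊓ LinearMap.ker d' : Submodule R M) ⧸
              (Submodule.map d' A).comap (A ⊓ LinearMap.ker d' : Submodule R M).subtype)
            ≃ₗ[R] ((LinearMap.ker d : Submodule R M) ⧸
              (LinearMap.range d).comap (LinearMap.ker d).subtype),
        ∀ x : (A ⊓ LinearMap.ker d' : Submodule R M),
          e (Submodule.Quotient.mk x) = Submodule.Quotient.mk (Submodule.inclusion hK x) := by
  have hK : A ⊓ LinearMap.ker d' ≤ LinearMap.ker d := fun x hx ↦ (hd' x hx.1).trans hx.2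
  have hdecomp : ∀ x : M, ∃ a ∈ A, ∃ b ∈ B, a + b = x := fun x ↦
    Submodule.mem_sup.1 (hAB.sup_eq_top ▸ Submodule.mem_top)
  have hzero : ∀ x ∈ A, x ∈ B → x = 0 := Submodule.disjoint_def.1 hAB.disjoint
  let f := ((LinearMap.range d).comap (LinearMap.ker d).subtype).mkQ ∘ₗ Submodule.inclusion hK
  have hker : (Submodule.map d' A).comap (A ⊓ LinearMap.ker d' : Submodule R M).subtype =
      LinearMap.ker f := by
    ext ⟨x, hxA, hx⟩
    simp only [f, Submodule.mem_comap, Submodule.subtype_apply, LinearMap.mem_ker,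
      LinearMap.comp_apply, Submodule.mkQ_apply, Submodule.Quotient.mk_eq_zero,
      Submodule.coe_inclusion]
    constructor
    · rintro ⟨a, ha, rfl⟩
      exact ⟨a, hd' a ha⟩
    · rintro ⟨w, rfl⟩
      obtain ⟨a, ha, b, hb, rfl⟩ := hdecomp w
      have hdb : d b = 0 := hzero _
        (by simpa using sub_mem hxA (hA a ha)) (hB b hb)
      exact ⟨a, ha, by rw [map_add, hdb, add_zero, hd' a ha]⟩
  have hsurj : Function.Surjective f := by
    intro q
    obtain ⟨⟨x, hx⟩, rfl⟩ := Submodule.Quotient.mk_surjective _ q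
    obtain ⟨a, ha, b, hb, rfl⟩ := hdecomp x
    have hsum : d a + d b = 0 := by rw [← map_add]; exact hx
    have hda : d a = 0 := hzero _ (hA a ha) (eq_neg_of_add_eq_zero_left hsum ▸ neg_mem (hB b hb))
    obtain ⟨y, -, hy⟩ := hacyclic b hb (by rwa [hda, zero_add] at hsum)
    refine ⟨⟨a, ha, (hd' a ha).symm.trans hda⟩, (Submodule.Quotient.eq _).2 ⟨-y, ?_⟩⟩
    simp [hy]
  exact ⟨hK, (Submodule.quotEquivOfEq _ _ hker).trans (f.quotKerEquivOfSurjective hsurj),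
    fun x ↦ rfl⟩

/-- Suppose the `ℤ`-graded complex `W = ⊕ₙ Wⁿ` (with anticommuting
differentials `d₁ : Wⁿ → Wⁿ⁺¹`, `d₂ : Wⁿ → Wⁿ⁻¹`) decomposes as
`Wⁿ = W'ⁿ ⊕ W''ⁿ` with both differentials preserving the parts, `d₁`
vanishing on `W'`, `W''` bounded below, and `d₁` acyclic on `W''`.  Then
the inclusion `W' ⊆ W` induces an isomorphism
`ker (d₂|_{W'}) / im (d₂|_{W'}) ≅ ker (d₁ + d₂) / im (d₁ + d₂)`. -/
theorem subcomplex_cohomology_iso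
    {W : Type*} [AddCommGroup W] [Module ℂ W]
    (𝒲 𝒲' 𝒲'' : ℤ → Submodule ℂ W) (hinternal : DirectSum.IsInternal 𝒲)
    (hsum : ∀ n : ℤ, 𝒲 n = 𝒲' n ⊔ 𝒲'' n)
    (hdisj : ∀ n : ℤ, 𝒲' n ⊓ 𝒲'' n = ⊥)
    (d1 d2 : W →ₗ[ℂ] W)
    (hmap1 : ∀ n : ℤ, Submodule.map d1 (𝒲 n) ≤ 𝒲 (n + 1))
    (hmap2 : ∀ n : ℤ, Submodule.map d2 (𝒲 n) ≤ 𝒲 (n - 1))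
    (hmap1' : ∀ n : ℤ, Submodule.map d1 (𝒲' n) ≤ 𝒲' (n + 1))
    (hmap2' : ∀ n : ℤ, Submodule.map d2 (𝒲' n) ≤ 𝒲' (n - 1))
    (hmap1'' : ∀ n : ℤ, Submodule.map d1 (𝒲'' n) ≤ 𝒲'' (n + 1))
    (hmap2'' : ∀ n : ℤ, Submodule.map d2 (𝒲'' n) ≤ 𝒲'' (n - 1))
    (hd1 : d1 ∘ₗ d1 = 0) (hd2 : d2 ∘ₗ d2 = 0)
    (hanti : d1 ∘ₗ d2 + d2 ∘ₗ d1 = 0)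
    (hvanish : ∀ n : ℤ, ∀ x ∈ 𝒲' n, d1 x = 0)
    (hbound : ∃ n0 : ℤ, ∀ n < n0, 𝒲'' n = ⊥)
    (hacyclic : ∀ n : ℤ,
      𝒲'' n ⊓ LinearMap.ker d1 = Submodule.map d1 (𝒲'' (n - 1))) :
    ∃ hK : (⨆ n : ℤ, 𝒲' n) ⊓ LinearMap.ker d2 ≤ LinearMap.ker (d1 + d2),
      ∃ e : (((⨆ n : ℤ, 𝒲' n) ⊓ LinearMap.ker d2 : Submodule ℂ W) ⧸
              (Submodule.map d2 (⨆ n : ℤ, 𝒲' n)).comap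
                ((⨆ n : ℤ, 𝒲' n) ⊓ LinearMap.ker d2 :
                  Submodule ℂ W).subtype)
            ≃ₗ[ℂ]
           ((LinearMap.ker (d1 + d2) : Submodule ℂ W) ⧸
              (LinearMap.range (d1 + d2)).comap
                (LinearMap.ker (d1 + d2)).subtype),
        ∀ x : ((⨆ n : ℤ, 𝒲' n) ⊓ LinearMap.ker d2 : Submodule ℂ W),
          e (Submodule.Quotient.mk x) =
            Submodule.Quotient.mk (Submodule.inclusion hK x) := by
  classical
  let _ : DirectSum.Decomposition 𝒲 := hinternal.chooseDecomposition
  have h' : ∀ n, 𝒲' n ≤ 𝒲 n := fun n ↦ hsum n ▸ le_sup_left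
  have h'' : ∀ n, 𝒲'' n ≤ 𝒲 n := fun n ↦ hsum n ▸ le_sup_right
  obtain ⟨n0, hn0⟩ := hbound
  have hdd : ∀ x, (d1 + d2) ((d1 + d2) x) = 0 := by
    intro x
    have h1 := LinearMap.congr_fun hd1 x
    have h2 := LinearMap.congr_fun hd2 x
    have h3 := LinearMap.congr_fun hanti x
    simp only [LinearMap.comp_apply, LinearMap.add_apply, LinearMap.zero_apply] at h1 h2 h3
    simp only [LinearMap.add_apply, map_add, h1, h2, zero_add, add_zero]
    rwa [add_comm] at h3
  have hd1A : ∀ x ∈ ⨆ n, 𝒲' n, d1 x = 0 := fun x hx ↦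
    (iSup_le hvanish : ⨆ n, 𝒲' n ≤ LinearMap.ker d1) hx
  have hcompl : IsCompl (⨆ n, 𝒲' n) (⨆ n, 𝒲'' n) := by
    refine ⟨disjoint_iSup_of_graded 𝒲 𝒲' 𝒲'' h' h'' hdisj, codisjoint_iff.2 ?_⟩
    rw [← iSup_sup_eq, ← hinternal.submodule_iSup_eq_top]
    exact iSup_congr fun n ↦ (hsum n).symm
  exact exists_cohomology_equiv_of_acyclic_compl _ _ hcompl (d1 + d2) d2
    (fun x hx ↦ add_mem (map_iSup_le_of_degree 𝒲' d1 1 hmap1' hx)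
      (map_iSup_le_of_degree 𝒲' d2 (-1) hmap2' hx))
    (fun x hx ↦ add_mem (map_iSup_le_of_degree 𝒲'' d1 1 hmap1'' hx)
      (map_iSup_le_of_degree 𝒲'' d2 (-1) hmap2'' hx))
    (fun x hx ↦ by rw [LinearMap.add_apply, hd1A x hx, zero_add])
    (fun x hx hdx ↦ exists_add_apply_eq_of_acyclic 𝒲 𝒲'' h'' d1 d2 hmap1 hmap2 hmap1'' hmap2''
      hdd n0 hn0 hacyclic hx hdx)
end

section
/- Let n be an integer with 1 ≤ n ≤ N+1 and q ∈ ℂ. In the ring S = ℂ[x_1, …, x_N, T, u]/(x_1⋯x_N·T − q^{N+1−n}·u^n), the images of the N+1 elements x_1 − T, x_2 − T, …, x_N − T, u − n·T form a regular sequence. -/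
open MvPolynomial

/-- The ideal `(x_1⋯x_N·T − q^{N+1−n}·uⁿ)` in `ℂ[x_1, …, x_N, T, u]`, the
variables being indexed by `Fin N ⊕ Fin 2`, with `x_i = X (inl i)`,
`T = X (inr 0)` and `u = X (inr 1)`. -/
noncomputable def hypIdeal (N n : ℕ) (q : ℂ) :
    Ideal (MvPolynomial (Fin N ⊕ Fin 2) ℂ) :=
  Ideal.span {((∏ i : Fin N, X (Sum.inl i)) * X (Sum.inr 0) -
    C (q ^ (N + 1 - n)) * X (Sum.inr 1) ^ n :
      MvPolynomial (Fin N ⊕ Fin 2) ℂ)}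

/-- If every initial segment of `rs` generates a prime ideal not containing the next element, and
`f` lies outside the ideal generated by `rs`, then `rs` is weakly regular modulo `f`. -/
theorem isWeaklyRegular_quotient_span_singleton {R : Type*} [CommRing R] (f : R) (rs : List R)
    (hprime : ∀ k ≤ rs.length, (Ideal.ofList (rs.take k)).IsPrime)
    (hnext : ∀ k (hk : k < rs.length), rs[k] ∉ Ideal.ofList (rs.take k))
    (hf : f ∉ Ideal.ofList rs) :
    RingTheory.Sequence.IsWeaklyRegular (R ⧸ Ideal.span {f})
      (rs.map (Ideal.Quotient.mk (Ideal.span {f}))) := by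
  refine ⟨fun k hk => ?_⟩
  rw [List.length_map] at hk
  rw [isSMulRegular_quotient_iff_mem_of_smul_mem]
  intro x hx
  obtain ⟨a, rfl⟩ := Ideal.Quotient.mk_surjective x
  rw [List.getElem_map, ← List.map_take, ← Ideal.map_ofList, smul_eq_mul, smul_eq_mul,
    Ideal.mul_top, ← map_mul, Ideal.mem_quotient_iff_mem_sup, Submodule.mem_sup] at hx
  rw [← List.map_take, ← Ideal.map_ofList, smul_eq_mul, Ideal.mul_top,
    Ideal.mem_quotient_iff_mem_sup]
  obtain ⟨y, hy, z, hz, hyz⟩ := hx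
  obtain ⟨b, rfl⟩ := Ideal.mem_span_singleton'.1 hz
  have hsucc : Ideal.ofList (rs.take (k + 1)) =
      Ideal.ofList (rs.take k) ⊔ Ideal.span {rs[k]} := by
    rw [← List.take_append_getElem hk, Ideal.ofList_append, Ideal.ofList_singleton]
  have hle : Ideal.ofList (rs.take (k + 1)) ≤ Ideal.ofList rs :=
    Ideal.span_mono fun _ h => List.mem_of_mem_take h
  have hb : b ∈ Ideal.ofList (rs.take (k + 1)) := by
    refine ((hprime (k + 1) hk).mem_or_mem ?_).resolve_right fun h => hf (hle h)
    rw [hsucc, eq_sub_of_add_eq' hyz]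
    exact sub_mem (Ideal.mul_mem_right _ _ (Ideal.mem_sup_right (Ideal.mem_span_singleton_self _)))
      (Ideal.mem_sup_left hy)
  rw [hsucc, Submodule.mem_sup] at hb
  obtain ⟨p, hp, w, hw, rfl⟩ := hb
  obtain ⟨c, rfl⟩ := Ideal.mem_span_singleton'.1 hw
  have hac : a - c * f ∈ Ideal.ofList (rs.take k) := by
    refine ((hprime k hk.le).mem_or_mem ?_).resolve_left (hnext k hk)
    have : rs[k] * (a - c * f) = y + p * f := by linear_combination -hyz
    rw [this]
    exact add_mem hy (Ideal.mul_mem_right _ _ hp)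
  rw [← sub_add_cancel a (c * f)]
  exact add_mem (Ideal.mem_sup_left hac)
    (Ideal.mem_sup_right (Ideal.mem_span_singleton'.2 ⟨c, rfl⟩))

/-- An ideal of a polynomial ring is prime if it is killed by an endomorphism that moves each
variable only by an element of the ideal. -/
theorem MvPolynomial.isPrime_of_le_ker_of_X_sub_mem {σ k : Type*} [CommRing k] [IsDomain k]
    {I : Ideal (MvPolynomial σ k)} (φ : MvPolynomial σ k →ₐ[k] MvPolynomial σ k)
    (hI : I ≤ RingHom.ker φ) (hX : ∀ s, X s - φ (X s) ∈ I) : I.IsPrime := by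
  have hcomp : (Ideal.Quotient.mkₐ k I).comp φ = Ideal.Quotient.mkₐ k I :=
    MvPolynomial.algHom_ext fun s => (Ideal.Quotient.eq.2 (hX s)).symm
  have hker : I = RingHom.ker φ := by
    refine le_antisymm hI fun p hp => ?_
    have h := DFunLike.congr_fun hcomp p
    rw [AlgHom.comp_apply, RingHom.mem_ker.1 hp, map_zero] at h
    exact Ideal.Quotient.eq_zero_iff_mem.1 h.symm
  rw [hker]
  exact RingHom.ker_isPrime φ

/-- The sequence `x_1 − T, …, x_N − T, u − n·T` in `ℂ[x_1, …, x_N, T, u]`. -/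
noncomputable def linearSeq (N n : ℕ) : List (MvPolynomial (Fin N ⊕ Fin 2) ℂ) :=
  (List.ofFn fun i : Fin N => X (Sum.inl i) - X (Sum.inr 0)) ++
    [X (Sum.inr 1) - C (n : ℂ) * X (Sum.inr 0)]

theorem length_linearSeq (N n : ℕ) : (linearSeq N n).length = N + 1 := by
  simp [linearSeq]

theorem getElem_linearSeq_of_lt {N n k : ℕ} (hk : k < N) (h : k < (linearSeq N n).length) :
    (linearSeq N n)[k] = X (Sum.inl ⟨k, hk⟩) - X (Sum.inr 0) := by
  simp [linearSeq, hk]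

theorem getElem_linearSeq_last {N n : ℕ} (h : N < (linearSeq N n).length) :
    (linearSeq N n)[N] = X (Sum.inr 1) - C (n : ℂ) * X (Sum.inr 0) := by
  simp [linearSeq]

theorem mem_take_linearSeq_iff {N n k : ℕ} {r : MvPolynomial (Fin N ⊕ Fin 2) ℂ} :
    r ∈ (linearSeq N n).take k ↔
      (∃ i : Fin N, (i : ℕ) < k ∧ X (Sum.inl i) - X (Sum.inr 0) = r) ∨
        (N < k ∧ X (Sum.inr 1) - C (n : ℂ) * X (Sum.inr 0) = r) := by
  rw [List.mem_take_iff_getElem]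
  constructor
  · rintro ⟨j, hj, rfl⟩
    have hlen := length_linearSeq N n
    rcases lt_or_eq_of_le (show j ≤ N by omega) with h | rfl
    · exact Or.inl ⟨⟨j, h⟩, by simp; omega, (getElem_linearSeq_of_lt h _).symm⟩
    · exact Or.inr ⟨by omega, (getElem_linearSeq_last _).symm⟩
  · rintro (⟨i, hi, rfl⟩ | ⟨hN, rfl⟩)
    · exact ⟨i, by rw [length_linearSeq]; omega, getElem_linearSeq_of_lt i.2 _⟩
    · exact ⟨N, by rw [length_linearSeq]; omega, getElem_linearSeq_last _⟩

/-- An algebra homomorphism identifying the variables as prescribed by the first `k` elements of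
`linearSeq N n` kills the ideal they generate. -/
theorem ofList_take_linearSeq_le_ker {N n k : ℕ} {A : Type*} [CommRing A] [Algebra ℂ A]
    (φ : MvPolynomial (Fin N ⊕ Fin 2) ℂ →ₐ[ℂ] A)
    (hx : ∀ i : Fin N, (i : ℕ) < k → φ (X (Sum.inl i)) = φ (X (Sum.inr 0)))
    (hu : N < k → φ (X (Sum.inr 1)) = (n : A) * φ (X (Sum.inr 0))) :
    Ideal.ofList ((linearSeq N n).take k) ≤ RingHom.ker φ := by
  refine Ideal.span_le.2 fun r hr => ?_
  rcases mem_take_linearSeq_iff.1 hr with ⟨i, hi, rfl⟩ | ⟨hN, rfl⟩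
  · simp [RingHom.mem_ker, hx i hi]
  · simp [RingHom.mem_ker, hu hN]

theorem isPrime_ofList_take_linearSeq (N n k : ℕ) :
    (Ideal.ofList ((linearSeq N n).take k)).IsPrime := by
  let φ : MvPolynomial (Fin N ⊕ Fin 2) ℂ →ₐ[ℂ] MvPolynomial (Fin N ⊕ Fin 2) ℂ :=
    aeval (Sum.elim (fun i => if (i : ℕ) < k then X (Sum.inr 0) else X (Sum.inl i))
      ![X (Sum.inr 0), if N < k then C (n : ℂ) * X (Sum.inr 0) else X (Sum.inr 1)])
  have hmem {r} (hr : r ∈ (linearSeq N n).take k) :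
      r ∈ Ideal.ofList ((linearSeq N n).take k) := Ideal.subset_span hr
  refine MvPolynomial.isPrime_of_le_ker_of_X_sub_mem φ
    (ofList_take_linearSeq_le_ker φ (fun i hi => by simp [φ, hi]) fun h => by simp [φ, h]) ?_
  rintro (i | j)
  · by_cases hi : (i : ℕ) < k
    · simpa [φ, hi] using hmem (mem_take_linearSeq_iff.2 (Or.inl ⟨i, hi, rfl⟩))
    · simp [φ, hi]
  · fin_cases j
    · simp [φ]
    · by_cases hN : N < k
      · simpa [φ, hN] using hmem (mem_take_linearSeq_iff.2 (Or.inr ⟨hN, rfl⟩))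
      · simp [φ, hN]

theorem getElem_linearSeq_notMem (N n k : ℕ) (hk : k < (linearSeq N n).length) :
    (linearSeq N n)[k] ∉ Ideal.ofList ((linearSeq N n).take k) := by
  let φ : MvPolynomial (Fin N ⊕ Fin 2) ℂ →ₐ[ℂ] ℂ :=
    aeval (Sum.elim (fun i => if (i : ℕ) < k then 0 else 1) ![0, 1])
  have hlen := length_linearSeq N n
  intro h
  have hzero : φ (linearSeq N n)[k] = 0 :=
    ofList_take_linearSeq_le_ker φ (fun i hi => by simp [φ, hi]) (fun h => by omega) h
  rcases lt_or_eq_of_le (show k ≤ N by omega) with hkN | rfl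
  · simp [getElem_linearSeq_of_lt hkN, φ] at hzero
  · simp [getElem_linearSeq_last, φ] at hzero

/-- The ideal generated by `linearSeq N n` vanishes on the line `x_i = T = t`, `u = n * t`. -/
theorem ofList_linearSeq_le_ker_aeval (N n : ℕ) (t : ℂ) :
    Ideal.ofList (linearSeq N n) ≤ RingHom.ker (aeval (R := ℂ)
      (Sum.elim (fun _ => t) ![t, n * t] : Fin N ⊕ Fin 2 → ℂ)) := by
  rw [← List.take_of_length_le (length_linearSeq N n).le]
  exact ofList_take_linearSeq_le_ker _ (by simp) (by simp)

theorem exists_pow_succ_sub_ne_zero {N n : ℕ} (hN : 1 ≤ N) (hn : n ≤ N + 1) (q : ℂ) :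
    ∃ t : ℂ, t ^ N * t - q ^ (N + 1 - n) * (n * t) ^ n ≠ 0 := by
  by_contra! h
  have h1 := h 1
  have h2 := h 2
  simp only [one_pow, mul_one, sub_eq_zero] at h1
  rw [mul_pow, ← mul_assoc, ← h1, one_mul, ← pow_succ, sub_eq_zero] at h2
  have hnN : N + 1 = n := Nat.pow_right_injective le_rfl (by exact_mod_cast h2)
  subst hnN
  rw [Nat.sub_self, pow_zero, one_mul] at h1
  have hpow : (N + 1) ^ (N + 1) = 1 := by exact_mod_cast h1.symm
  rw [Nat.pow_eq_one] at hpow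
  omega

/-- In `S = ℂ[x_1, …, x_N, T, u]/(x_1⋯x_N·T − q^{N+1−n}·uⁿ)`, the images of
the `N+1` elements `x_1 − T, …, x_N − T, u − n·T` form a regular
sequence. -/
theorem regular_sequence_hypersurface (N : ℕ) (hN : 1 ≤ N) (n : ℕ)
    (hn1 : 1 ≤ n) (hn2 : n ≤ N + 1) (q : ℂ) :
    RingTheory.Sequence.IsRegular
      (MvPolynomial (Fin N ⊕ Fin 2) ℂ ⧸ hypIdeal N n q)
      ((List.ofFn fun i : Fin N =>
          Ideal.Quotient.mk (hypIdeal N n q) (X (Sum.inl i) - X (Sum.inr 0))) ++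
        [Ideal.Quotient.mk (hypIdeal N n q)
          (X (Sum.inr 1) - C (n : ℂ) * X (Sum.inr 0))]) := by
  set f : MvPolynomial (Fin N ⊕ Fin 2) ℂ := (∏ i : Fin N, X (Sum.inl i)) * X (Sum.inr 0) -
    C (q ^ (N + 1 - n)) * X (Sum.inr 1) ^ n with hf
  have haeval : ∀ t : ℂ, aeval (Sum.elim (fun _ => t) ![t, n * t] : Fin N ⊕ Fin 2 → ℂ) f =
      t ^ N * t - q ^ (N + 1 - n) * (n * t) ^ n := fun t => by simp [hf]
  have hI : hypIdeal N n q = Ideal.span {f} := rfl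
  have hseq : (List.ofFn fun i : Fin N =>
      Ideal.Quotient.mk (hypIdeal N n q) (X (Sum.inl i) - X (Sum.inr 0))) ++
        [Ideal.Quotient.mk (hypIdeal N n q) (X (Sum.inr 1) - C (n : ℂ) * X (Sum.inr 0))] =
      (linearSeq N n).map (Ideal.Quotient.mk (hypIdeal N n q)) := by
    simp [linearSeq, List.map_ofFn, Function.comp_def]
  rw [hseq, hI]
  refine ⟨isWeaklyRegular_quotient_span_singleton f _
    (fun k _ => isPrime_ofList_take_linearSeq N n k) (getElem_linearSeq_notMem N n) ?_, ?_⟩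
  · obtain ⟨t, ht⟩ := exists_pow_succ_sub_ne_zero hN hn2 q
    intro h
    exact ht ((haeval t).symm.trans (ofList_linearSeq_le_ker_aeval N n t h))
  · rw [← Ideal.map_ofList, smul_eq_mul, Ideal.mul_top]
    refine fun htop => RingHom.ker_ne_top (aeval (R := ℂ)
      (Sum.elim (fun _ => 0) ![0, n * 0] : Fin N ⊕ Fin 2 → ℂ)) ((Ideal.eq_top_iff_one _).2 ?_)
    have hone : (1 : MvPolynomial (Fin N ⊕ Fin 2) ℂ) ∈
        Ideal.ofList (linearSeq N n) ⊔ Ideal.span {f} := by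
      rw [← Ideal.mem_quotient_iff_mem_sup, ← htop]
      trivial
    refine sup_le (ofList_linearSeq_le_ker_aeval N n 0) ?_ hone
    rw [Ideal.span_singleton_le_iff_mem, RingHom.mem_ker, haeval]
    simp [show n ≠ 0 by omega]
end

section
/- Let n ≥ 1 be an integer and let M ⊆ ℤ^{N+1} be the submonoid generated by the standard basis vectors e_1, …, e_N, e_{N+1} together with ν = n·e_{N+1} − (e_1 + ⋯ + e_N). Then the monoid algebra ℂ[M] is isomorphic as a ℂ-algebra to ℂ[x_1, …, x_N, u, T]/(x_1⋯x_N·T − u^n), via the map sending x_i to the basis element of ℂ[M] indexed by e_i (1 ≤ i ≤ N), u to the one indexed by e_{N+1}, and T to the one indexed by ν. -/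
open MvPolynomial

/-- The vector `ν = n·e_{N+1} − (e_1 + ⋯ + e_N)` in `ℤ^{N+1}`. -/
noncomputable def nuVec (N n : ℕ) : Fin (N + 1) → ℤ :=
  (n : ℤ) • Pi.single (Fin.last N) 1 -
    ∑ i : Fin N, Pi.single i.castSucc (1 : ℤ)

/-- The submonoid `M ⊆ ℤ^{N+1}` generated by the standard basis vectors
`e_1, …, e_{N+1}` together with `ν`. -/
noncomputable def latticeMonoid (N n : ℕ) : AddSubmonoid (Fin (N + 1) → ℤ) :=
  AddSubmonoid.closure
    (insert (nuVec N n) (Set.range fun i : Fin (N + 1) => Pi.single i (1 : ℤ)))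

theorem nuVec_castSucc (N n : ℕ) (i : Fin N) : nuVec N n i.castSucc = -1 := by
  simp [nuVec, Finset.sum_apply, Pi.single_apply, Fin.castSucc_ne_last]

theorem nuVec_last (N n : ℕ) : nuVec N n (Fin.last N) = n := by
  simp [nuVec, Finset.sum_apply, Fin.castSucc_ne_last]

/-- The element `e_i` of the monoid `M`. -/
noncomputable def latticeBasis (N n : ℕ) (i : Fin (N + 1)) : latticeMonoid N n :=
  ⟨Pi.single i 1, AddSubmonoid.subset_closure (Set.mem_insert_iff.mpr (Or.inr ⟨i, rfl⟩))⟩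

/-- The element `ν` of the monoid `M`. -/
noncomputable def latticeNu (N n : ℕ) : latticeMonoid N n :=
  ⟨nuVec N n, AddSubmonoid.subset_closure (Set.mem_insert _ _)⟩

/-- The relation `e_1 + ⋯ + e_N + ν = n·e_{N+1}` in `M`. -/
theorem sum_latticeBasis_add_latticeNu (N n : ℕ) :
    ∑ i : Fin N, latticeBasis N n i.castSucc + latticeNu N n =
      n • latticeBasis N n (Fin.last N) := by
  apply Subtype.ext
  simp [latticeBasis, latticeNu, nuVec]

/-- Every element of `M` is `∑ aᵢ eᵢ + p e_{N+1} + q ν` with natural coefficients, written here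
coordinatewise. -/
theorem exists_coeff_of_mem_latticeMonoid {N n : ℕ} {m : Fin (N + 1) → ℤ}
    (hm : m ∈ latticeMonoid N n) :
    ∃ (a : Fin N → ℕ) (p q : ℕ),
      (∀ i, m i.castSucc = a i - q) ∧ m (Fin.last N) = p + n * q := by
  induction hm using AddSubmonoid.closure_induction with
  | mem m hm =>
    rcases hm with rfl | ⟨i, rfl⟩
    · exact ⟨0, 0, 1, by simp [nuVec_castSucc], by simp [nuVec_last]⟩
    · induction i using Fin.lastCases with
      | last => exact ⟨0, 1, 0, by simp [Fin.castSucc_ne_last], by simp⟩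
      | cast i =>
        exact ⟨Pi.single i 1, 0, 0, by simp [Pi.single_apply],
          by simp [Fin.castSucc_ne_last]⟩
  | zero => exact ⟨0, 0, 0, by simp, by simp⟩
  | add m m' _ _ h h' =>
    obtain ⟨a, p, q, h1, h2⟩ := h
    obtain ⟨a', p', q', h1', h2'⟩ := h'
    refine ⟨a + a', p + p', q + q', fun i => ?_, ?_⟩
    · simp only [Pi.add_apply, h1, h1']; push_cast; ring
    · simp only [Pi.add_apply, h2, h2']; push_cast; ring

/-- Two monomials in `x`, `u`, `t` with the same lattice point agree once `x_1⋯x_N·t = uⁿ`. -/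
theorem prod_pow_mul_pow_eq {R : Type*} [CommMonoid R] {N n : ℕ} {x : Fin N → R} {u t : R}
    (h : (∏ i, x i) * t = u ^ n) {a b : Fin N → ℕ} {p q r s : ℕ}
    (hab : ∀ i, (a i : ℤ) - q = b i - s) (hpr : (p : ℤ) + n * q = r + n * s) :
    (∏ i, x i ^ a i) * u ^ p * t ^ q = (∏ i, x i ^ b i) * u ^ r * t ^ s := by
  wlog hqs : q ≤ s generalizing a b p q r s
  · exact (this (fun i => (hab i).symm) hpr.symm (le_of_not_ge hqs)).symm
  obtain ⟨k, rfl⟩ := Nat.exists_eq_add_of_le hqs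
  have hb : b = fun i => a i + k := by
    funext i
    have := hab i
    push_cast at this
    omega
  have hp : p = r + n * k := by
    zify
    push_cast at hpr
    linarith
  subst hb hp
  simp only [pow_add, Finset.prod_mul_distrib, Finset.prod_pow, pow_mul, ← h, mul_pow]
  ac_rfl

/-- The universal property of `M`: it is the commutative monoid generated by `e_1, …, e_{N+1}, ν`
subject to `e_1 + ⋯ + e_N + ν = n·e_{N+1}`. -/
theorem exists_latticeMonoid_hom {R : Type*} [CommMonoid R] {N n : ℕ} {x : Fin N → R} {u t : R}
    (h : (∏ i, x i) * t = u ^ n) :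
    ∃ g : Multiplicative (latticeMonoid N n) →* R,
      (∀ i, g (.ofAdd (latticeBasis N n (Fin.castSucc i))) = x i) ∧
      g (.ofAdd (latticeBasis N n (Fin.last N))) = u ∧ g (.ofAdd (latticeNu N n)) = t := by
  choose a p q hm hl using
    fun m : latticeMonoid N n => exists_coeff_of_mem_latticeMonoid m.2
  have key (m : latticeMonoid N n) (b : Fin N → ℕ) (r s : ℕ)
      (hb : ∀ i, m.1 (Fin.castSucc i) = b i - s) (hr : m.1 (Fin.last N) = r + n * s) :
      (∏ i, x i ^ a m i) * u ^ p m * t ^ q m = (∏ i, x i ^ b i) * u ^ r * t ^ s :=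
    prod_pow_mul_pow_eq h (fun i => (hm m i).symm.trans (hb i)) ((hl m).symm.trans hr)
  refine ⟨{ toFun := fun m => (∏ i, x i ^ a m.toAdd i) * u ^ p m.toAdd * t ^ q m.toAdd
            map_one' := ?_
            map_mul' := fun m m' => ?_ }, fun i => ?_, ?_, ?_⟩
  · exact (key 0 0 0 0 (by simp) (by simp)).trans (by simp)
  · refine (key (m.toAdd + m'.toAdd) (a m.toAdd + a m'.toAdd) (p m.toAdd + p m'.toAdd)
      (q m.toAdd + q m'.toAdd) (fun i => ?_) ?_).trans ?_
    · rw [AddSubmonoid.coe_add, Pi.add_apply, hm, hm, Pi.add_apply]; push_cast; ring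
    · rw [AddSubmonoid.coe_add, Pi.add_apply, hl, hl]; push_cast; ring
    · simp only [Pi.add_apply, pow_add, Finset.prod_mul_distrib]
      ac_rfl
  · refine (key (latticeBasis N n i.castSucc) (Pi.single i 1) 0 0
      (by simp [latticeBasis, Pi.single_apply])
      (by simp [latticeBasis, Fin.castSucc_ne_last])).trans ?_
    simp [Pi.single_apply, pow_ite]
  · exact (key (latticeBasis N n (Fin.last N)) 0 1 0
      (by simp [latticeBasis, Fin.castSucc_ne_last])
      (by simp [latticeBasis])).trans (by simp)
  · exact (key (latticeNu N n) 0 0 1 (by simp [latticeNu, nuVec_castSucc])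
      (by simp [latticeNu, nuVec_last])).trans (by simp)

/-- Homomorphisms out of `M` are determined by their values on the generators. -/
theorem latticeMonoid_hom_ext {R : Type*} [MulOneClass R] {N n : ℕ}
    {g g' : Multiplicative (latticeMonoid N n) →* R}
    (hb : ∀ i, g (.ofAdd (latticeBasis N n i)) = g' (.ofAdd (latticeBasis N n i)))
    (hν : g (.ofAdd (latticeNu N n)) = g' (.ofAdd (latticeNu N n))) : g = g' := by
  ext ⟨m, hm⟩
  change g (.ofAdd ⟨m, hm⟩) = g' (.ofAdd ⟨m, hm⟩)
  induction hm using AddSubmonoid.closure_induction with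
  | mem m hm =>
    rcases hm with rfl | ⟨i, rfl⟩
    · exact hν
    · exact hb i
  | zero => exact (map_one g).trans (map_one g').symm
  | add m m' hm hm' h h' =>
    have := congrArg₂ (· * ·) h h'
    simp only [← map_mul] at this
    exact this

/-- The monoid algebra `ℂ[M]` is isomorphic to
`ℂ[x_1, …, x_N, u, T]/(x_1⋯x_N·T − uⁿ)` via `x_i ↦ e_i`, `u ↦ e_{N+1}`,
`T ↦ ν`.  Here the polynomial variables are indexed by `Fin N ⊕ Fin 2`,
with `x_i = X (inl i)`, `u = X (inr 0)` and `T = X (inr 1)`. -/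
theorem monoid_algebra_presentation (N : ℕ) (hN : 1 ≤ N) (n : ℕ) (hn : 1 ≤ n) :
    ∃ f : (MvPolynomial (Fin N ⊕ Fin 2) ℂ ⧸
        Ideal.span {((∏ i : Fin N, X (Sum.inl i)) * X (Sum.inr 1) -
          X (Sum.inr 0) ^ n : MvPolynomial (Fin N ⊕ Fin 2) ℂ)})
          ≃ₐ[ℂ] AddMonoidAlgebra ℂ (latticeMonoid N n),
      (∀ i : Fin N,
        f (Ideal.Quotient.mk _ (X (Sum.inl i))) =
          AddMonoidAlgebra.single
            ⟨Pi.single i.castSucc 1,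
              AddSubmonoid.subset_closure
                (Set.mem_insert_iff.mpr (Or.inr ⟨i.castSucc, rfl⟩))⟩ 1) ∧
      f (Ideal.Quotient.mk _ (X (Sum.inr 0))) =
        AddMonoidAlgebra.single
          ⟨Pi.single (Fin.last N) 1,
            AddSubmonoid.subset_closure
              (Set.mem_insert_iff.mpr (Or.inr ⟨Fin.last N, rfl⟩))⟩ 1 ∧
      f (Ideal.Quotient.mk _ (X (Sum.inr 1))) =
        AddMonoidAlgebra.single
          ⟨nuVec N n, AddSubmonoid.subset_closure (Set.mem_insert _ _)⟩ 1 := by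
  set r : MvPolynomial (Fin N ⊕ Fin 2) ℂ :=
    (∏ i : Fin N, X (Sum.inl i)) * X (Sum.inr 1) - X (Sum.inr 0) ^ n with hr
  let φ : MvPolynomial (Fin N ⊕ Fin 2) ℂ →ₐ[ℂ] AddMonoidAlgebra ℂ (latticeMonoid N n) :=
    aeval (Sum.elim (fun i => AddMonoidAlgebra.of ℂ _ (.ofAdd (latticeBasis N n i.castSucc)))
      ![AddMonoidAlgebra.of ℂ _ (.ofAdd (latticeBasis N n (Fin.last N))),
        AddMonoidAlgebra.of ℂ _ (.ofAdd (latticeNu N n))])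
  have hφr : φ r = 0 := by
    simp only [hr, φ, map_sub, map_mul, map_prod, map_pow, aeval_X, Sum.elim_inl, Sum.elim_inr,
      Matrix.cons_val_zero, Matrix.cons_val_one]
    rw [sub_eq_zero, ← map_prod, ← map_mul, ← map_pow, ← ofAdd_sum, ← ofAdd_add, ← ofAdd_nsmul,
      sum_latticeBasis_add_latticeNu]
  have hφ : ∀ a ∈ Ideal.span {r}, φ a = 0 := by
    intro a ha
    obtain ⟨c, rfl⟩ := Ideal.mem_span_singleton.mp ha
    rw [map_mul, hφr, zero_mul]
  have hrel : (∏ i : Fin N, Ideal.Quotient.mk (Ideal.span {r}) (X (Sum.inl i))) *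
      Ideal.Quotient.mk (Ideal.span {r}) (X (Sum.inr 1)) =
      Ideal.Quotient.mk (Ideal.span {r}) (X (Sum.inr 0)) ^ n := by
    rw [← map_prod, ← map_mul, ← map_pow, Ideal.Quotient.eq]
    exact Ideal.mem_span_singleton_self r
  obtain ⟨g, hgx, hgu, hgt⟩ := exists_latticeMonoid_hom hrel
  let F := Ideal.Quotient.liftₐ (Ideal.span {r}) φ hφ
  let G := AddMonoidAlgebra.lift ℂ (MvPolynomial (Fin N ⊕ Fin 2) ℂ ⧸ Ideal.span {r}) _ g
  have hFx (i : Fin N) : F (Ideal.Quotient.mk _ (X (Sum.inl i))) =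
      AddMonoidAlgebra.of ℂ _ (.ofAdd (latticeBasis N n i.castSucc)) := by
    exact aeval_X _ _
  have hFu : F (Ideal.Quotient.mk _ (X (Sum.inr 0))) =
      AddMonoidAlgebra.of ℂ _ (.ofAdd (latticeBasis N n (Fin.last N))) := by
    exact aeval_X _ _
  have hFt : F (Ideal.Quotient.mk _ (X (Sum.inr 1))) =
      AddMonoidAlgebra.of ℂ _ (.ofAdd (latticeNu N n)) := by
    exact aeval_X _ _
  have hG (m) : G (AddMonoidAlgebra.of ℂ _ m) = g m := AddMonoidAlgebra.lift_of g m
  refine ⟨AlgEquiv.ofAlgHom F G ?_ ?_, hFx, hFu, hFt⟩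
  · apply (AddMonoidAlgebra.lift ℂ _ _).symm.injective
    refine latticeMonoid_hom_ext (fun i => ?_) ?_
    · change F (G (AddMonoidAlgebra.of ℂ _ _)) = AddMonoidAlgebra.of ℂ _ _
      rw [hG]
      induction i using Fin.lastCases with
      | last => rw [hgu, hFu]
      | cast i => rw [hgx, hFx]
    · change F (G (AddMonoidAlgebra.of ℂ _ _)) = AddMonoidAlgebra.of ℂ _ _
      rw [hG, hgt, hFt]
  · refine Ideal.Quotient.algHom_ext _ (MvPolynomial.algHom_ext fun j => ?_)
    change G (F (Ideal.Quotient.mk _ (X j))) = Ideal.Quotient.mk _ (X j)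
    rcases j with i | j
    · rw [hFx, hG, hgx]
    · fin_cases j
      · exact (congrArg G hFu).trans ((hG _).trans hgu)
      · exact (congrArg G hFt).trans ((hG _).trans hgt)
end

section
/- Let q ∈ ℂ be nonzero. In the Laurent polynomial ring ℂ[t_1^{±1}, …, t_N^{±1}], the N elements t_i − q^{N+1}·(t_1⋯t_N)^{−1}, for i = 1, …, N, form a regular sequence, and the quotient ring ℂ[t_1^{±1}, …, t_N^{±1}]/(t_1 − q^{N+1}(t_1⋯t_N)^{−1}, …, t_N − q^{N+1}(t_1⋯t_N)^{−1}) is isomorphic as a ℂ-algebra to ℂ[T]/(T^{N+1} − q^{N+1}). -/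
/-- The element `t_i − q^{N+1}·(t_1⋯t_N)^{−1}` of the Laurent polynomial
ring `ℂ[t_1^{±1}, …, t_N^{±1}]`, realized as the monoid algebra of the
group `ℤ^N` over `ℂ`. -/
noncomputable def laurentElt (N : ℕ) (q : ℂ) (i : Fin N) :
    AddMonoidAlgebra ℂ (Fin N → ℤ) :=
  AddMonoidAlgebra.single (Pi.single i (1 : ℤ)) 1 -
    AddMonoidAlgebra.single (fun _ => (-1 : ℤ)) (q ^ (N + 1))

section LaurentEval

variable {ι k A : Type*} [Fintype ι] [CommRing k] [CommRing A] [Algebra k A]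

/-- Evaluation of Laurent polynomials at a family of units. -/
noncomputable def laurentEval (w : ι → Aˣ) : AddMonoidAlgebra k (ι → ℤ) →ₐ[k] A :=
  AddMonoidAlgebra.lift k A (ι → ℤ)
    ((Units.coeHom A).comp
      { toFun := fun a => ∏ i, w i ^ (a.toAdd i)
        map_one' := by simp
        map_mul' := fun a b => by simp [zpow_add, Finset.prod_mul_distrib] })

lemma laurentEval_single (w : ι → Aˣ) (a : ι → ℤ) (c : k) :
    laurentEval w (AddMonoidAlgebra.single a c) = c • ((∏ i, w i ^ a i : Aˣ) : A) := by
  simp [laurentEval]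

lemma laurentEval_var [DecidableEq ι] (w : ι → Aˣ) (i : ι) :
    laurentEval w (AddMonoidAlgebra.single (Pi.single i (1 : ℤ)) (1 : k)) = w i := by
  rw [laurentEval_single, one_smul, Finset.prod_eq_single i]
  · simp
  · intro j _ hj
    simp [hj]
  · simp

lemma laurentEval_inv_prod (w : ι → Aˣ) (c : k) :
    laurentEval w (AddMonoidAlgebra.single (fun _ => (-1 : ℤ)) c) =
      c • (((∏ i, w i)⁻¹ : Aˣ) : A) := by
  rw [laurentEval_single]
  simp only [zpow_neg_one, Finset.prod_inv_distrib]

lemma laurent_algHom_ext [DecidableEq ι] {f g : AddMonoidAlgebra k (ι → ℤ) →ₐ[k] A}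
    (h : ∀ i, f (AddMonoidAlgebra.single (Pi.single i (1 : ℤ)) 1) =
      g (AddMonoidAlgebra.single (Pi.single i (1 : ℤ)) 1)) : f = g := by
  apply (AddMonoidAlgebra.lift k A (ι → ℤ)).symm.injective
  apply MonoidHom.toAdditiveRight.injective
  apply AddMonoidHom.functions_ext'
  intro i
  apply AddMonoidHom.ext_int
  exact congrArg Additive.ofMul (h i)

/-- The variable `t_i` as a unit of the Laurent polynomial ring. -/
noncomputable def laurentVar (k : Type*) [CommRing k] [DecidableEq ι] (i : ι) :
    (AddMonoidAlgebra k (ι → ℤ))ˣ :=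
  (AddMonoidAlgebra.of k (ι → ℤ)).toHomUnits (Multiplicative.ofAdd (Pi.single i 1))

lemma coe_laurentVar {κ : Type*} [DecidableEq κ] (i : κ) :
    (laurentVar k i : AddMonoidAlgebra k (κ → ℤ)) =
      AddMonoidAlgebra.single (Pi.single i (1 : ℤ)) 1 := rfl

lemma laurentEval_laurentVar [DecidableEq ι] :
    laurentEval (laurentVar k) = AlgHom.id k (AddMonoidAlgebra k (ι → ℤ)) :=
  laurent_algHom_ext fun i => laurentEval_var _ i

lemma coe_inv_prod_laurentVar [DecidableEq ι] :
    (((∏ i, laurentVar k i)⁻¹ : (AddMonoidAlgebra k (ι → ℤ))ˣ) : AddMonoidAlgebra k (ι → ℤ)) =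
      AddMonoidAlgebra.single (fun _ => (-1 : ℤ)) 1 := by
  have h := laurentEval_inv_prod (laurentVar (ι := ι) k) (1 : k)
  rw [laurentEval_laurentVar, one_smul] at h
  exact h.symm

end LaurentEval

section RegularSequence

open RingTheory.Sequence

variable {R : Type*} [CommRing R]

lemma ofList_take_ofFn {N : ℕ} (r : Fin N → R) (k : Fin N) :
    Ideal.ofList ((List.ofFn r).take k) = Ideal.span (r '' Set.Iio k) := by
  unfold Ideal.ofList
  congr 1
  ext x
  simp only [Set.mem_ofPred_eq, List.mem_take_iff_getElem, List.getElem_ofFn, List.length_ofFn,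
    Set.mem_image, Set.mem_Iio]
  constructor
  · rintro ⟨j, hj, rfl⟩
    exact ⟨⟨j, by omega⟩, Fin.lt_def.2 (by simp; omega), rfl⟩
  · rintro ⟨i, hi, rfl⟩
    exact ⟨i, by have := Fin.lt_def.1 hi; omega, rfl⟩

lemma ofList_ofFn {N : ℕ} (r : Fin N → R) :
    Ideal.ofList (List.ofFn r) = Ideal.span (Set.range r) := by
  unfold Ideal.ofList
  congr 1
  ext x
  simp [List.mem_ofFn]

/-- A sequence in a domain is weakly regular if every proper initial segment generates the kernel
of an endomorphism, congruent to the identity modulo that segment, which does not kill the next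
element. -/
lemma isWeaklyRegular_ofFn_of_endomorphisms [IsDomain R] {N : ℕ} (r : Fin N → R)
    (φ : Fin N → R →+* R) (hzero : ∀ k, ∀ i < k, φ k (r i) = 0) (hne : ∀ k, φ k (r k) ≠ 0)
    (hsub : ∀ k x, φ k x - x ∈ Ideal.span (r '' Set.Iio k)) :
    IsWeaklyRegular R (List.ofFn r) := by
  refine ⟨fun j hj => ?_⟩
  obtain ⟨k, rfl⟩ : ∃ k : Fin N, (k : ℕ) = j := ⟨⟨j, by simpa using hj⟩, rfl⟩
  rw [isSMulRegular_quotient_iff_mem_of_smul_mem, ofList_take_ofFn]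
  simp only [List.getElem_ofFn, smul_eq_mul, Ideal.mul_top, Fin.eta]
  intro x hx
  have hker : Ideal.span (r '' Set.Iio k) ≤ RingHom.ker (φ k) := by
    rw [Ideal.span_le]
    rintro _ ⟨i, hi, rfl⟩
    exact hzero k i hi
  have h0 : φ k x = 0 := by
    have := hker hx
    rw [RingHom.mem_ker, map_mul] at this
    exact (mul_eq_zero.1 this).resolve_left (hne k)
  simpa [h0] using hsub k x

end RegularSequence

lemma laurentEval_laurentElt {A : Type*} [CommRing A] [Algebra ℂ A] {N : ℕ} (q : ℂ)
    (w : Fin N → Aˣ) (i : Fin N) :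
    laurentEval w (laurentElt N q i) = w i - q ^ (N + 1) • (((∏ i, w i)⁻¹ : Aˣ) : A) := by
  rw [laurentElt, map_sub, laurentEval_var, laurentEval_inv_prod]

/-- The unit `c·(t_1⋯t_N)^{−1}` of the Laurent polynomial ring. -/
noncomputable def scaledInvProd (N : ℕ) (c : ℂˣ) : (AddMonoidAlgebra ℂ (Fin N → ℤ))ˣ :=
  Units.map (algebraMap ℂ (AddMonoidAlgebra ℂ (Fin N → ℤ))) c * (∏ i, laurentVar ℂ i)⁻¹

lemma coe_scaledInvProd (N : ℕ) (c : ℂˣ) :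
    (scaledInvProd N c : AddMonoidAlgebra ℂ (Fin N → ℤ)) =
      AddMonoidAlgebra.single (fun _ => (-1 : ℤ)) (c : ℂ) := by
  rw [scaledInvProd, Units.val_mul, coe_inv_prod_laurentVar]
  simp

lemma laurentElt_eq {N : ℕ} {q : ℂ} {c : ℂˣ} (hc : (c : ℂ) = q ^ (N + 1)) (i : Fin N) :
    laurentElt N q i = (laurentVar ℂ i : AddMonoidAlgebra ℂ (Fin N → ℤ)) - scaledInvProd N c := by
  rw [coe_scaledInvProd, hc, laurentElt, coe_laurentVar]

/-- The images of the variables under the endomorphism that fixes `(t_1⋯t_{n+1})^{−1}`, sends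
`t_i` to `c·(t_1⋯t_{n+1})^{−1}` for `i < k`, and fixes the other variables but the last. -/
noncomputable def partialImages (n : ℕ) (c : ℂˣ) (k : Fin (n + 1)) :
    Fin (n + 1) → (AddMonoidAlgebra ℂ (Fin (n + 1) → ℤ))ˣ :=
  Fin.snoc (α := fun _ => (AddMonoidAlgebra ℂ (Fin (n + 1) → ℤ))ˣ)
    (fun i : Fin n => if i.castSucc < k then scaledInvProd (n + 1) c else laurentVar ℂ i.castSucc)
    ((∏ i, laurentVar ℂ i) *
      (∏ i : Fin n, if i.castSucc < k then scaledInvProd (n + 1) c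
        else laurentVar ℂ i.castSucc)⁻¹)

section PartialImages

variable {n : ℕ} {c : ℂˣ} {k : Fin (n + 1)}

lemma partialImages_castSucc (i : Fin n) :
    partialImages n c k i.castSucc =
      if i.castSucc < k then scaledInvProd (n + 1) c else laurentVar ℂ i.castSucc := by
  simp [partialImages]

lemma prod_partialImages : ∏ i, partialImages n c k i = ∏ i, laurentVar ℂ i := by
  rw [Fin.prod_univ_castSucc]
  simp [partialImages]

lemma partialImages_of_lt {i : Fin (n + 1)} (h : i < k) :
    partialImages n c k i = scaledInvProd (n + 1) c := by
  induction i using Fin.lastCases with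
  | last => exact absurd h (Fin.le_last k).not_gt
  | cast i => rw [partialImages_castSucc, if_pos h]

lemma laurentEval_partialImages {q : ℂ} (hc : (c : ℂ) = q ^ (n + 1 + 1)) (i : Fin (n + 1)) :
    laurentEval (partialImages n c k) (laurentElt (n + 1) q i) =
      partialImages n c k i - scaledInvProd (n + 1) c := by
  rw [laurentEval_laurentElt, prod_partialImages, ← hc, coe_scaledInvProd,
    coe_inv_prod_laurentVar]
  simp

lemma partialImages_self_ne : partialImages n c k k ≠ scaledInvProd (n + 1) c := by
  intro h
  induction k using Fin.lastCases with
  | last =>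
    have hall : ∀ i, partialImages n c (Fin.last n) i = scaledInvProd (n + 1) c := by
      intro i
      rcases (Fin.le_last i).lt_or_eq with hi | rfl
      exacts [partialImages_of_lt hi, h]
    have hprod := prod_partialImages (n := n) (c := c) (k := Fin.last n)
    simp only [hall, Finset.prod_const, Finset.card_univ, Fintype.card_fin] at hprod
    have h3 : (AddMonoidAlgebra.single (fun _ => (-1 : ℤ)) (1 : ℂ) :
        AddMonoidAlgebra ℂ (Fin (n + 1) → ℤ)) *
        (AddMonoidAlgebra.single (fun _ => (-1 : ℤ)) (c : ℂ)) ^ (n + 1) = 1 := by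
      rw [← coe_inv_prod_laurentVar, ← coe_scaledInvProd, ← Units.val_pow_eq_pow_val, hprod,
        Units.inv_mul]
    rw [AddMonoidAlgebra.single_pow, AddMonoidAlgebra.single_mul_single,
      AddMonoidAlgebra.one_def] at h3
    rcases (AddMonoidAlgebra.single_inj).1 h3 with ⟨h4, -⟩ | ⟨-, h4⟩
    · have := congrFun h4 0
      simp at this
      omega
    · exact one_ne_zero h4
  | cast i =>
    rw [partialImages_castSucc, if_neg (lt_irrefl _), Units.ext_iff, coe_laurentVar,
      coe_scaledInvProd] at h
    rcases (AddMonoidAlgebra.single_inj).1 h with ⟨h4, -⟩ | ⟨h4, -⟩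
    · have := congrFun h4 i.castSucc
      simp at this
    · exact one_ne_zero h4

lemma mk_comp_laurentEval_partialImages {q : ℂ} (hc : (c : ℂ) = q ^ (n + 1 + 1)) :
    (Ideal.Quotient.mkₐ ℂ (Ideal.span (laurentElt (n + 1) q '' Set.Iio k))).comp
        (laurentEval (partialImages n c k)) =
      Ideal.Quotient.mkₐ ℂ (Ideal.span (laurentElt (n + 1) q '' Set.Iio k)) := by
  set π := Ideal.Quotient.mkₐ ℂ (Ideal.span (laurentElt (n + 1) q '' Set.Iio k))
  let πu := Units.map (π : AddMonoidAlgebra ℂ (Fin (n + 1) → ℤ) →*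
    AddMonoidAlgebra ℂ (Fin (n + 1) → ℤ) ⧸ Ideal.span (laurentElt (n + 1) q '' Set.Iio k))
  have hcast (i : Fin n) :
      πu (partialImages n c k i.castSucc) = πu (laurentVar ℂ i.castSucc) := by
    rw [partialImages_castSucc]
    split_ifs with hi
    · refine Units.ext (sub_eq_zero.1 ?_).symm
      change π _ - π _ = 0
      rw [← map_sub, ← laurentElt_eq hc]
      exact Ideal.Quotient.eq_zero_iff_mem.2 (Ideal.subset_span ⟨_, hi, rfl⟩)
    · rfl
  have hall (i : Fin (n + 1)) : πu (partialImages n c k i) = πu (laurentVar ℂ i) := by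
    induction i using Fin.lastCases with
    | cast i => exact hcast i
    | last =>
      have h := congrArg πu (prod_partialImages (n := n) (c := c) (k := k))
      rw [map_prod, map_prod, Fin.prod_univ_castSucc, Fin.prod_univ_castSucc,
        Finset.prod_congr rfl fun i _ => hcast i] at h
      exact mul_left_cancel h
  refine laurent_algHom_ext fun i => ?_
  rw [AlgHom.comp_apply, laurentEval_var]
  exact congrArg Units.val (hall i)

end PartialImages

lemma isWeaklyRegular_laurentElt (n : ℕ) {q : ℂ} (hq : q ≠ 0) :
    RingTheory.Sequence.IsWeaklyRegular (AddMonoidAlgebra ℂ (Fin (n + 1) → ℤ))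
      (List.ofFn (laurentElt (n + 1) q)) := by
  let c := Units.mk0 (q ^ (n + 1 + 1)) (pow_ne_zero _ hq)
  have hc : (c : ℂ) = q ^ (n + 1 + 1) := rfl
  refine isWeaklyRegular_ofFn_of_endomorphisms _
    (fun k => (laurentEval (partialImages n c k)).toRingHom) ?_ ?_ ?_
  · intro k i hi
    change laurentEval _ _ = 0
    rw [laurentEval_partialImages hc, partialImages_of_lt hi, sub_self]
  · intro k
    change laurentEval _ _ ≠ 0
    rw [laurentEval_partialImages hc, sub_ne_zero, Ne, ← Units.ext_iff]
    exact partialImages_self_ne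
  · intro k x
    exact Ideal.Quotient.eq.1 (DFunLike.congr_fun (mk_comp_laurentEval_partialImages hc) x)

lemma span_laurentElt_ne_top (N : ℕ) {q : ℂ} (hq : q ≠ 0) :
    Ideal.span (Set.range (laurentElt N q)) ≠ ⊤ := by
  have h : Ideal.span (Set.range (laurentElt N q)) ≤
      RingHom.ker (laurentEval fun _ : Fin N => Units.mk0 q hq) := by
    rw [Ideal.span_le]
    rintro _ ⟨i, rfl⟩
    rw [SetLike.mem_coe, RingHom.mem_ker, laurentEval_laurentElt]
    simp [pow_succ', hq]
  exact fun htop => RingHom.ker_ne_top _ (top_le_iff.1 (htop ▸ h))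

section Quotient

open Polynomial

variable {N : ℕ} {q : ℂ}

lemma exists_unit_eq_root (N : ℕ) (hq : q ≠ 0) :
    ∃ T : (ℂ[X] ⧸ Ideal.span {(X ^ (N + 1) - C (q ^ (N + 1)) : ℂ[X])})ˣ,
      (T : ℂ[X] ⧸ Ideal.span {(X ^ (N + 1) - C (q ^ (N + 1)) : ℂ[X])}) =
        Ideal.Quotient.mkₐ ℂ _ X ∧
      (T : ℂ[X] ⧸ Ideal.span {(X ^ (N + 1) - C (q ^ (N + 1)) : ℂ[X])}) ^ (N + 1) =
        algebraMap ℂ _ (q ^ (N + 1)) := by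
  have h : Ideal.Quotient.mkₐ ℂ (Ideal.span {(X ^ (N + 1) - C (q ^ (N + 1)) : ℂ[X])}) X ^ (N + 1) =
      algebraMap ℂ _ (q ^ (N + 1)) := by
    rw [← map_pow]
    exact Ideal.Quotient.eq.2 (Ideal.mem_span_singleton_self _)
  have hc : IsUnit (q ^ (N + 1)) := (pow_ne_zero _ hq).isUnit
  have hu := (isUnit_pow_iff (Nat.succ_ne_zero N)).1 (h ▸ hc.map (algebraMap ℂ _))
  exact ⟨hu.unit, rfl, h⟩

lemma nonempty_quotient_algEquiv (N : ℕ) (hq : q ≠ 0) :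
    Nonempty ((AddMonoidAlgebra ℂ (Fin N → ℤ) ⧸ Ideal.span (Set.range (laurentElt N q))) ≃ₐ[ℂ]
      (ℂ[X] ⧸ Ideal.span {(X ^ (N + 1) - C (q ^ (N + 1)) : ℂ[X])})) := by
  let c := Units.mk0 (q ^ (N + 1)) (pow_ne_zero _ hq)
  have hc : (c : ℂ) = q ^ (N + 1) := rfl
  set J := Ideal.span {(X ^ (N + 1) - C (q ^ (N + 1)) : ℂ[X])}
  set I := Ideal.span (Set.range (laurentElt N q))
  obtain ⟨T, hTX, hT⟩ : ∃ T : (ℂ[X] ⧸ J)ˣ, (T : ℂ[X] ⧸ J) = Ideal.Quotient.mkₐ ℂ J X ∧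
      (T : ℂ[X] ⧸ J) ^ (N + 1) = algebraMap ℂ _ (q ^ (N + 1)) := exists_unit_eq_root N hq
  let π := Ideal.Quotient.mkₐ ℂ I
  let πu := Units.map (π : AddMonoidAlgebra ℂ (Fin N → ℤ) →* AddMonoidAlgebra ℂ (Fin N → ℤ) ⧸ I)
  have hπ (i : Fin N) : πu (laurentVar ℂ i) = πu (scaledInvProd N c) := by
    refine Units.ext (sub_eq_zero.1 ?_)
    change π _ - π _ = 0
    rw [← map_sub, ← laurentElt_eq hc]
    exact Ideal.Quotient.eq_zero_iff_mem.2 (Ideal.subset_span ⟨i, rfl⟩)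
  have hV : π (scaledInvProd N c) ^ (N + 1) = algebraMap ℂ _ (c : ℂ) := by
    have h : πu (scaledInvProd N c) =
        πu (Units.map (algebraMap ℂ (AddMonoidAlgebra ℂ (Fin N → ℤ))) c) *
          (πu (scaledInvProd N c) ^ N)⁻¹ := by
      conv_lhs => rw [scaledInvProd, map_mul, map_inv, map_prod]
      simp only [hπ, Finset.prod_const, Finset.card_univ, Fintype.card_fin]
    rw [eq_mul_inv_iff_mul_eq, ← pow_succ'] at h
    exact congrArg Units.val h
  have hTinv : (c : ℂ) • (((∏ _i : Fin N, T)⁻¹ : (ℂ[X] ⧸ J)ˣ) : ℂ[X] ⧸ J) = T := by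
    refine (Algebra.smul_def (c : ℂ) (((∏ _i : Fin N, T)⁻¹ : (ℂ[X] ⧸ J)ˣ) : ℂ[X] ⧸ J)).trans ?_
    rw [hc, ← hT, Units.mul_inv_eq_iff_eq_mul]
    simp [pow_succ']
  let F : (AddMonoidAlgebra ℂ (Fin N → ℤ) ⧸ I) →ₐ[ℂ] ℂ[X] ⧸ J :=
    Ideal.Quotient.liftₐ I (laurentEval fun _ => T) fun a ha => by
      have hI : I ≤ RingHom.ker (laurentEval (k := ℂ) fun _ : Fin N => T) := by
        rw [Ideal.span_le]
        rintro _ ⟨i, rfl⟩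
        rw [SetLike.mem_coe, RingHom.mem_ker, laurentEval_laurentElt, ← hc, hTinv, sub_self]
      exact hI ha
  let G : (ℂ[X] ⧸ J) →ₐ[ℂ] AddMonoidAlgebra ℂ (Fin N → ℤ) ⧸ I :=
    Ideal.Quotient.liftₐ J (aeval (π (scaledInvProd N c))) fun a ha => by
      have hJ : J ≤ RingHom.ker (aeval (R := ℂ) (π (scaledInvProd N c))) := by
        rw [Ideal.span_le, Set.singleton_subset_iff, SetLike.mem_coe, RingHom.mem_ker]
        simp only [map_sub, map_pow, aeval_X, aeval_C]
        rw [← map_pow (algebraMap ℂ _), ← hc, sub_eq_zero]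
        exact hV
      exact hJ ha
  have hFπ (x) : F (π x) = laurentEval (fun _ => T) x := rfl
  have hG (p : ℂ[X]) : G (Ideal.Quotient.mkₐ ℂ J p) = aeval (π (scaledInvProd N c)) p := rfl
  refine ⟨AlgEquiv.ofAlgHom F G ?_ ?_⟩
  · refine Ideal.Quotient.algHom_ext _ (Polynomial.algHom_ext ?_)
    change F (G (Ideal.Quotient.mkₐ ℂ J X)) = Ideal.Quotient.mkₐ ℂ J X
    rw [hG, aeval_X, hFπ, coe_scaledInvProd, laurentEval_inv_prod, hTinv, hTX]
  · refine Ideal.Quotient.algHom_ext _ (laurent_algHom_ext fun i => ?_)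
    change G (F (π _)) = π _
    rw [hFπ, laurentEval_var, hTX, hG, aeval_X]
    exact (congrArg Units.val (hπ i)).symm

end Quotient

/-- For `q ≠ 0`, the `N` elements `t_i − q^{N+1}·(t_1⋯t_N)^{−1}` form a
regular sequence in `ℂ[t_1^{±1}, …, t_N^{±1}]`, and the quotient is
isomorphic to `ℂ[T]/(T^{N+1} − q^{N+1})`. -/
theorem laurent_regular_sequence_and_quotient (N : ℕ) (hN : 1 ≤ N)
    (q : ℂ) (hq : q ≠ 0) :
    RingTheory.Sequence.IsRegular (AddMonoidAlgebra ℂ (Fin N → ℤ))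
        (List.ofFn (laurentElt N q)) ∧
      Nonempty
        ((AddMonoidAlgebra ℂ (Fin N → ℤ) ⧸
            Ideal.span (Set.range (laurentElt N q)))
          ≃ₐ[ℂ]
         (Polynomial ℂ ⧸
            Ideal.span {(Polynomial.X ^ (N + 1) -
              Polynomial.C (q ^ (N + 1)) : Polynomial ℂ)})) := by
  obtain ⟨n, rfl⟩ : ∃ n, N = n + 1 := ⟨N - 1, by omega⟩
  refine ⟨⟨isWeaklyRegular_laurentElt n hq, ?_⟩, nonempty_quotient_algEquiv _ hq⟩
  rw [smul_eq_mul, Ideal.mul_top, ofList_ofFn]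
  exact (span_laurentElt_ne_top _ hq).symm
end
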